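/- arXiv:2001.00934 — 5 statements merged into one kernel-verified Lean document; each statement's English description precedes it below -/
import Mathlib

section
/- With β_m, β_g, η and Ω as defined from the melonic flow equations, the Ward constraint C = 0 holds if and only if ḡ = 0 or ḡ = −(2/π²)(1 + m̄²). -/
open Real

/-- The Ward constraint in factorised form, with `a = 1 + m` and `x = π² g`. -/
theorem ward_constraint_factorisation (a x g η D : ℝ) (ha : a ≠ 0)
    (hD : D = a ^ 2 * (a ^ 2 - x) + (2 / 3) * (a + 1) * x ^ 2)
    (hη : η * D = 4 * x * (a ^ 2 - x * (a + 1))) :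
    (-2 * η * g + 4 * g * x * (1 + η / 6) / a ^ 3 * (1 - x * (1 / a ^ 2 + (1 + 1 / a)))
      + η * g * (a ^ 2 - x) / a ^ 2
      - 2 * x * g * (-(2 + η) * (a - 1) - 10 * x * (1 + η / 6) / a ^ 2) / a ^ 3) * D
      = 16 * x ^ 2 * g * (2 * a + x) / (3 * a ^ 2) := by
  have expand : (-2 * η * g
      + 4 * g * x * (1 + η / 6) / a ^ 3 * (1 - x * (1 / a ^ 2 + (1 + 1 / a)))
      + η * g * (a ^ 2 - x) / a ^ 2
      - 2 * x * g * (-(2 + η) * (a - 1) - 10 * x * (1 + η / 6) / a ^ 2) / a ^ 3) * D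
      = 4 * x * g * (1 / a ^ 2 + x * (4 - a - a ^ 2) / a ^ 5) * D
        + g * (-1 + x / a ^ 2 - 4 * x / (3 * a ^ 3)
          + 2 / 3 * x ^ 2 * (4 - a - a ^ 2) / a ^ 5) * (η * D) := by
    field_simp
    ring
  rw [expand, hη, hD]
  field_simp
  ring

/-- The Ward constraint `C = 0` on the melonic flow holds iff `ḡ = 0` or
`ḡ = −(2/π²)(1 + m̄²)`. -/
theorem ward_constraint_solutions
    (m g Ω D η βm βg C : ℝ)
    (hm : 1 + m ≠ 0)
    (hΩ : Ω = (1 + m) ^ 2 - π ^ 2 * g)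
    (hD : D = (1 + m) ^ 2 * Ω + (2 / 3) * (2 + m) * g ^ 2 * π ^ 4)
    (hD0 : D ≠ 0)
    (hη : η = 4 * g * π ^ 2 * ((1 + m) ^ 2 - g * π ^ 2 * (2 + m)) / D)
    (hβm : βm = -(2 + η) * m - 10 * g * π ^ 2 * (1 + η / 6) / (1 + m) ^ 2)
    (hβg : βg = -2 * η * g + 4 * g ^ 2 * π ^ 2 * (1 + η / 6) / (1 + m) ^ 3 *
      (1 - π ^ 2 * g * (1 / (1 + m) ^ 2 + (1 + 1 / (1 + m)))))
    (hC : C = βg + η * g * Ω / (1 + m) ^ 2 - 2 * π ^ 2 * g ^ 2 * βm / (1 + m) ^ 3) :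
    C = 0 ↔ (g = 0 ∨ g = -(2 / π ^ 2) * (1 + m)) := by
  have hpi : π ^ 2 ≠ 0 := pow_ne_zero 2 Real.pi_ne_zero
  have key : C * D =
      16 * (π ^ 2 * g) ^ 2 * g * (2 * (1 + m) + π ^ 2 * g) / (3 * (1 + m) ^ 2) := by
    have hηD : η * D = 4 * (π ^ 2 * g) * ((1 + m) ^ 2 - π ^ 2 * g * (1 + m + 1)) := by
      rw [hη, div_mul_cancel₀ _ hD0]
      ring
    rw [← ward_constraint_factorisation (1 + m) (π ^ 2 * g) g η D hm
      (by rw [hD, hΩ]; ring) hηD, hC, hβg, hβm, hΩ]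
    ring
  have root : 2 * (1 + m) + π ^ 2 * g = 0 ↔ g = -(2 / π ^ 2) * (1 + m) := by
    constructor <;> intro h
    · field_simp
      linarith
    · rw [h]
      field_simp
      ring
  rw [← root, ← mul_eq_zero_iff_right hD0, key]
  simp [hm]
end

section
/- On the constrained branch ḡ = −(2/π²)(1 + m̄²), assuming m̄² ≠ −5 and m̄² ≠ −5/3 and 1+m̄² ≠ 0, the anomalous dimension equals η = −24/(m̄² + 5) and the mass beta function equals β_m = (20 − 2(m̄² − 7)m̄²)/(m̄² + 5). -/
open Real

/-- On the constrained branch `ḡ = −(2/π²)(1 + m̄²)` the anomalous dimension equals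
`η = −24/(m̄² + 5)` and the mass beta function equals
`β_m = (20 − 2(m̄² − 7)m̄²)/(m̄² + 5)`. -/
theorem ward_branch_nontrivial
    (m g Ω D η βm : ℝ)
    (hm : 1 + m ≠ 0) (hm5 : m ≠ -5) (hm53 : m ≠ -5 / 3)
    (hΩ : Ω = (1 + m) ^ 2 - π ^ 2 * g)
    (hD : D = (1 + m) ^ 2 * Ω + (2 / 3) * (2 + m) * g ^ 2 * π ^ 4)
    (hD0 : D ≠ 0)
    (hη : η = 4 * g * π ^ 2 * ((1 + m) ^ 2 - g * π ^ 2 * (2 + m)) / D)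
    (hβm : βm = -(2 + η) * m - 10 * g * π ^ 2 * (1 + η / 6) / (1 + m) ^ 2)
    (hg : g = -(2 / π ^ 2) * (1 + m)) :
    η = -24 / (m + 5) ∧ βm = (20 - 2 * (m - 7) * m) / (m + 5) := by
  have hgπ : g * π ^ 2 = -2 * (1 + m) := by
    rw [hg]
    field_simp
  have h5 : m + 5 ≠ 0 := fun h => hm5 (by linarith)
  have h53 : 3 * m + 5 ≠ 0 := fun h => hm53 (by linarith)
  have hDfactor : D = (1 + m) ^ 2 * (3 * m + 5) * (m + 5) / 3 := by
    have hΩ' : Ω = (1 + m) ^ 2 + 2 * (1 + m) := by linear_combination hΩ - hgπ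
    have hsq : g ^ 2 * π ^ 4 = 4 * (1 + m) ^ 2 := by
      linear_combination (g * π ^ 2 - 2 * (1 + m)) * hgπ
    rw [hD, hΩ']
    linear_combination (2 / 3) * (2 + m) * hsq
  have hnum : 4 * g * π ^ 2 * ((1 + m) ^ 2 - g * π ^ 2 * (2 + m)) =
      -8 * (1 + m) ^ 2 * (3 * m + 5) := by
    rw [mul_assoc 4 g, hgπ]
    ring
  have hη' : η = -24 / (m + 5) := by
    rw [hη, hnum, div_eq_div_iff hD0 h5, hDfactor]
    ring
  refine ⟨hη', ?_⟩
  rw [hβm, mul_assoc 10 g, hgπ, hη']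
  field_simp
  ring
end

section
/- For the single-interaction model, whose mass beta function is β_m⁽¹⁾ := −(2+η)m̄² − 2ḡπ²(1+η/6)/(1+m̄²)² while β_g, η, Ω are unchanged, the branch ḡ = (m̄²+1)²/(π²(m̄²+2)) (for m̄² ≠ −2, 1+m̄² ≠ 0, and nonvanishing denominator D) satisfies η = 0 and solves the Ward constraint C₁ := β_g + ηḡΩ/(1+m̄²)² − 2π²ḡ²β_m⁽¹⁾/(1+m̄²)³ = 0. -/
open Real

/-- Single-interaction model: on the branch `ḡ = (m̄²+1)²/(π²(m̄²+2))` the anomalous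
dimension vanishes and the Ward constraint
`C₁ = β_g + ηḡΩ/(1+m̄²)² − 2π²ḡ²β_m⁽¹⁾/(1+m̄²)³` is solved. -/
theorem single_interaction_ward_branch
    (m g Ω D η βm1 βg C1 : ℝ)
    (hm : 1 + m ≠ 0) (hm2 : m ≠ -2)
    (hΩ : Ω = (1 + m) ^ 2 - π ^ 2 * g)
    (hD : D = (1 + m) ^ 2 * Ω + (2 / 3) * (2 + m) * g ^ 2 * π ^ 4)
    (hD0 : D ≠ 0)
    (hη : η = 4 * g * π ^ 2 * ((1 + m) ^ 2 - g * π ^ 2 * (2 + m)) / D)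
    (hβm1 : βm1 = -(2 + η) * m - 2 * g * π ^ 2 * (1 + η / 6) / (1 + m) ^ 2)
    (hβg : βg = -2 * η * g + 4 * g ^ 2 * π ^ 2 * (1 + η / 6) / (1 + m) ^ 3 *
      (1 - π ^ 2 * g * (1 / (1 + m) ^ 2 + (1 + 1 / (1 + m)))))
    (hC1 : C1 = βg + η * g * Ω / (1 + m) ^ 2 - 2 * π ^ 2 * g ^ 2 * βm1 / (1 + m) ^ 3)
    (hg : g = (m + 1) ^ 2 / (π ^ 2 * (m + 2))) :
    η = 0 ∧ C1 = 0 := by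
  have hm2' : m + 2 ≠ 0 := fun h => hm2 (by linarith)
  have hbranch : g * π ^ 2 * (2 + m) = (1 + m) ^ 2 := by
    have hπ : π ≠ 0 := pi_ne_zero
    rw [hg]
    field_simp
    ring
  have hη0 : η = 0 := by
    rw [hη, hbranch, sub_self, mul_zero, zero_div]
  refine ⟨hη0, ?_⟩
  have hfactor : C1 = 4 * g ^ 2 * π ^ 2 / (1 + m) ^ 4 *
      ((1 + m) ^ 2 - g * π ^ 2 * (2 + m)) := by
    rw [hC1, hβg, hβm1, hη0]
    field_simp
    ring
  rw [hfactor, hbranch, sub_self, mul_zero]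
end

section
/- For ḡ = −(m̄²+1)²(3m̄²+2)/π² (with 1+m̄² ≠ 0 and all denominators below nonzero), the anomalous dimension determined by the dynamically closed Ward relation, η₁ := 12π²ḡ/Ω₁ with Ω₁ := (1+m̄²) − 2π²ḡ, coincides with the anomalous dimension η := 4ḡπ²[(1+m̄²)² − ḡπ²(2+m̄²)]/[(1+m̄²)²((1+m̄²)²−π²ḡ) + (2/3)(2+m̄²)ḡ²π⁴] of the effective vertex expansion. -/
open Real

/-- On the branch `ḡ = −(m̄²+1)²(3m̄²+2)/π²`, the anomalous dimension
`η₁ = 12π²ḡ/Ω₁` fixed by the dynamically closed Ward relation coincides with the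
anomalous dimension `η` of the effective vertex expansion. -/
theorem dynamical_eta_matches_EVE_eta
    (m g Ω1 D η1 η : ℝ)
    (hm : 1 + m ≠ 0)
    (hg : g = -((m + 1) ^ 2 * (3 * m + 2)) / π ^ 2)
    (hΩ1 : Ω1 = (1 + m) - 2 * π ^ 2 * g)
    (hΩ10 : Ω1 ≠ 0)
    (hD : D = (1 + m) ^ 2 * ((1 + m) ^ 2 - π ^ 2 * g) + (2 / 3) * (2 + m) * g ^ 2 * π ^ 4)
    (hD0 : D ≠ 0)
    (hη1 : η1 = 12 * π ^ 2 * g / Ω1)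
    (hη : η = 4 * g * π ^ 2 * ((1 + m) ^ 2 - g * π ^ 2 * (2 + m)) / D) :
    η1 = η := by
  have hx : π ^ 2 * g = -((m + 1) ^ 2 * (3 * m + 2)) := by
    rw [hg]
    field_simp
  have key : 3 * D = ((1 + m) ^ 2 - g * π ^ 2 * (2 + m)) * Ω1 := by
    have hD' : D = (1 + m) ^ 2 * ((1 + m) ^ 2 - π ^ 2 * g)
        + (2 / 3) * (2 + m) * (π ^ 2 * g) ^ 2 := by
      rw [hD]
      ring
    rw [hD', hΩ1, mul_assoc 2, mul_comm g, hx]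
    ring
  rw [hη1, hη, div_eq_div_iff hΩ10 hD0]
  linear_combination 4 * π ^ 2 * g * key
end

section
/- There exist real numbers m̄² ∈ (−0.6, −0.5) and ḡ ∈ (0.0001, 0.01) such that β_m = 0 and β_g = 0 simultaneously; i.e. the melonic flow equations admit a real non-Gaussian (Wilson–Fisher-like) fixed point p₁ ≈ (ḡ*, m̄²*) ≈ (0.002, −0.54). -/
open Real

/-- Denominator of the anomalous dimension. -/
noncomputable def flowD (m g : ℝ) : ℝ :=
  (1 + m) ^ 2 * ((1 + m) ^ 2 - π ^ 2 * g) + (2 / 3) * (2 + m) * g ^ 2 * π ^ 4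

/-- Anomalous dimension `η` of the melonic effective vertex expansion. -/
noncomputable def flowEta (m g : ℝ) : ℝ :=
  4 * g * π ^ 2 * ((1 + m) ^ 2 - g * π ^ 2 * (2 + m)) / flowD m g

/-- Mass beta function `β_m` of the melonic effective vertex expansion. -/
noncomputable def flowBetaM (m g : ℝ) : ℝ :=
  -(2 + flowEta m g) * m - 10 * g * π ^ 2 * (1 + flowEta m g / 6) / (1 + m) ^ 2

/-- Coupling beta function `β_g` of the melonic effective vertex expansion. -/
noncomputable def flowBetaG (m g : ℝ) : ℝ :=
  -2 * flowEta m g * g + 4 * g ^ 2 * π ^ 2 * (1 + flowEta m g / 6) / (1 + m) ^ 3 *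
    (1 - π ^ 2 * g * (1 / (1 + m) ^ 2 + (1 + 1 / (1 + m))))

/-- A common root of two quadratics with vanishing resultant. -/
lemma quadratics_common_root {A B C A' B' C' : ℝ} (hd : A * B' - A' * B ≠ 0)
    (hres : (A' * C - A * C') ^ 2 = (A * B' - A' * B) * (B * C' - B' * C)) {a : ℝ}
    (ha : a * (A * B' - A' * B) = A' * C - A * C') :
    A * a ^ 2 + B * a + C = 0 ∧ A' * a ^ 2 + B' * a + C' = 0 := by
  have hsq : a ^ 2 * (A * B' - A' * B) = B * C' - B' * C := by
    apply mul_left_cancel₀ hd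
    rw [← hres, ← ha]
    ring
  constructor <;> apply mul_left_cancel₀ hd
  · linear_combination A * hsq + B * ha
  · linear_combination A' * hsq + B' * ha

/-- The flow equations in the variables `a = 1 + m` and `t = π² g / a²`, cleared of
denominators, have a common solution. -/
lemma exists_reduced_fixed_point :
    ∃ a t : ℝ, a ∈ Set.Ioo (0.4 : ℝ) 0.5 ∧ t ∈ Set.Icc (0.12 : ℝ) 0.125 ∧
      (2 + 2 * t - 8 / 3 * t ^ 2 * (1 + a)) * (1 - a) = 10 * t * (1 - t / 3) ∧
      2 * (1 - t * (1 + a)) * a = (1 - t / 3) * (1 - t * (1 + a + a ^ 2)) := by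
  let A : ℝ → ℝ := fun t => 8 / 3 * t ^ 2
  let B : ℝ → ℝ := fun t => -(2 + 2 * t)
  let C : ℝ → ℝ := fun t => 2 - 8 * t + 2 / 3 * t ^ 2
  let A' : ℝ → ℝ := fun t => -t - t ^ 2 / 3
  let B' : ℝ → ℝ := fun t => 2 - t - t ^ 2 / 3
  let C' : ℝ → ℝ := fun t => -(1 - t / 3) * (1 - t)
  let R : ℝ → ℝ := fun t => (A' t * C t - A t * C' t) ^ 2 -
    (A t * B' t - A' t * B t) * (B t * C' t - B' t * C t)
  have hR : ContinuousOn R (Set.Icc 0.12 0.125) := by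
    simp only [R, A, B, C, A', B', C']
    fun_prop
  obtain ⟨t, ⟨h₁, h₂⟩, ht⟩ := intermediate_value_Icc (by norm_num) hR
    (show (0 : ℝ) ∈ Set.Icc (R 0.12) (R 0.125) by
      constructor <;> norm_num [R, A, B, C, A', B', C'])
  have hd : A t * B' t - A' t * B t < 0 := by
    simp only [A, B, A', B']
    nlinarith [mul_nonneg (sub_nonneg.2 h₁) (sub_nonneg.2 h₂), sq_nonneg t,
      pow_nonneg (by linarith : 0 ≤ t) 3, pow_nonneg (by linarith : 0 ≤ t) 4]
  have ha : (A' t * C t - A t * C' t) / (A t * B' t - A' t * B t) *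
      (A t * B' t - A' t * B t) = A' t * C t - A t * C' t := div_mul_cancel₀ _ hd.ne
  obtain ⟨e₁, e₂⟩ := quadratics_common_root hd.ne (sub_eq_zero.1 ht) ha
  refine ⟨(A' t * C t - A t * C' t) / (A t * B' t - A' t * B t), t, ⟨?_, ?_⟩, ⟨h₁, h₂⟩, ?_, ?_⟩
  rotate_left 2
  · simp only [A, B, C] at e₁
    linear_combination e₁
  · simp only [A', B', C'] at e₂
    linear_combination e₂
  · rw [lt_div_iff_of_neg hd]
    simp only [A, B, C, A', B', C']
    have h0 : 0 ≤ t := by linarith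
    have k₁ := mul_nonneg (sub_nonneg.2 h₁) (sub_nonneg.2 h₂)
    nlinarith [mul_nonneg h0 k₁, mul_nonneg (pow_nonneg h0 2) k₁]
  · rw [div_lt_iff_of_neg hd]
    simp only [A, B, C, A', B', C']
    have h0 : 0 ≤ t := by linarith
    have k₁ := mul_nonneg (sub_nonneg.2 h₁) (sub_nonneg.2 h₂)
    nlinarith [mul_nonneg h0 k₁, mul_nonneg (pow_nonneg h0 2) k₁]

/-- The melonic flow equations admit a real non-Gaussian (Wilson–Fisher-like) fixed
point `p₁ ≈ (ḡ*, m̄²*) ≈ (0.002, −0.54)`. -/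
theorem wilson_fisher_fixed_point_exists :
    ∃ m g : ℝ, m ∈ Set.Ioo (-0.6 : ℝ) (-0.5 : ℝ) ∧
      g ∈ Set.Ioo (0.0001 : ℝ) (0.01 : ℝ) ∧
      flowBetaM m g = 0 ∧ flowBetaG m g = 0 := by
  obtain ⟨a, t, ⟨ha₁, ha₂⟩, ⟨ht₁, ht₂⟩, e₁, e₂⟩ := exists_reduced_fixed_point
  have ha : 0 < a := by linarith
  have ht : 0 < t := by linarith
  have hπ : (9 : ℝ) < π ^ 2 := by nlinarith [pi_gt_three]
  have hπ' : π ^ 2 < 16 := by nlinarith [pi_lt_four, pi_pos]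
  have hE : 0 < 1 - t + 2 / 3 * (1 + a) * t ^ 2 := by
    have : 0 < 2 / 3 * (1 + a) * t ^ 2 := by positivity
    linarith
  have hx : a ^ 2 * t / π ^ 2 * π ^ 2 = a ^ 2 * t := div_mul_cancel₀ _ (by positivity)
  have hD : flowD (a - 1) (a ^ 2 * t / π ^ 2) =
      a ^ 4 * (1 - t + 2 / 3 * (1 + a) * t ^ 2) := by
    unfold flowD
    linear_combination (-a ^ 2 + 2 / 3 * (1 + a) *
      (a ^ 2 * t / π ^ 2 * π ^ 2 + a ^ 2 * t)) * hx
  have hη : flowEta (a - 1) (a ^ 2 * t / π ^ 2) =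
      4 * t * (1 - t * (1 + a)) / (1 - t + 2 / 3 * (1 + a) * t ^ 2) := by
    unfold flowEta
    rw [hD, div_eq_div_iff (by positivity) hE.ne', mul_assoc 4, hx]
    ring
  set η := flowEta (a - 1) (a ^ 2 * t / π ^ 2) with η_def
  have hη' : η * (1 - t + 2 / 3 * (1 + a) * t ^ 2) = 4 * t * (1 - t * (1 + a)) := by
    rw [hη, div_mul_cancel₀ _ hE.ne']
  have hsq : 0.16 < a ^ 2 ∧ a ^ 2 < 0.25 := by constructor <;> nlinarith
  refine ⟨a - 1, a ^ 2 * t / π ^ 2, ⟨by linarith, by linarith⟩, ⟨?_, ?_⟩, ?_, ?_⟩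
  · rw [lt_div_iff₀ (by positivity)]
    nlinarith
  · rw [div_lt_iff₀ (by positivity)]
    nlinarith
  · have key : (2 + η) * (1 - a) - 10 * t * (1 + η / 6) = 0 := by
      apply mul_left_cancel₀ hE.ne'
      linear_combination (1 - a - 10 * t / 6) * hη' + e₁
    unfold flowBetaM
    rw [← η_def, mul_assoc 10, hx, ← key, add_sub_cancel]
    field_simp
    ring
  · have key : -2 * η * a + 4 * t * (1 + η / 6) * (1 - t * (1 + a + a ^ 2)) = 0 := by
      apply mul_left_cancel₀ hE.ne'
      linear_combination (-2 * a + 2 / 3 * t * (1 - t * (1 + a + a ^ 2))) * hη' - 4 * t * e₂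
    unfold flowBetaG
    rw [← η_def, ← mul_zero (a * t / π ^ 2), ← key, add_sub_cancel]
    field_simp
    ring
end
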